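/- Let A₁, A₂, A₃ ∈ ℂ[x,y,z] be polynomials, each a product of linear forms, A_i = ∏_{j=1}^{r_i} L_{i,j} with r_i ≥ 0 (an empty product equals 1), such that the linear forms L_{i,j} are pairwise non-proportional and for every nonzero point P ∈ ℂ³ at most 3 of the forms L_{i,j} vanish at P. Suppose there exist nonzero homogeneous polynomials f, g, h ∈ ℂ[x,y,z] with A₁f³ + A₂g³ + A₃h³ = 0. Then there exist polynomials B₁, B₂, B₃ ∈ ℂ[x,y,z], each a product of linear forms (possibly an empty product, i.e. a nonzero constant), a nonzero constant c ∈ ℂ, and nonzero constants λ₁, λ₂, λ₃ ∈ ℂ such that B₁B₂B₃ = c·A₁A₂A₃ and λ₁B₁ + λ₂B₂ + λ₃B₃ = 0. -/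

import Mathlib

open MvPolynomial

namespace Catalan

abbrev R := MvPolynomial (Fin 3) ℂ

lemma exists_coeffs {l : R} (h : l.IsHomogeneous 1) :
    ∃ v : Fin 3 → ℂ, l = ∑ k, C (v k) * X k := by
  have h1 : l ∈ homogeneousSubmodule (Fin 3) ℂ 1 := h
  rw [homogeneousSubmodule_one_eq_span_X, Submodule.mem_span_range_iff_exists_fun] at h1
  obtain ⟨v, hv⟩ := h1
  exact ⟨v, by rw [← hv]; simp [smul_eq_C_mul]⟩

lemma eval_lin (v P : Fin 3 → ℂ) :
    eval P (∑ k, C (v k) * X k : R) = ∑ k, v k * P k := by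
  simp

lemma irreducible_lin {l : R} (h0 : l ≠ 0) (h : l.IsHomogeneous 1) : Irreducible l := by
  apply irreducible_of_totalDegree_eq_one (h.totalDegree h0)
  intro x hx
  rw [isUnit_iff_ne_zero]
  rintro rfl
  apply h0
  ext i
  simpa using hx i

lemma prime_lin {l : R} (h0 : l ≠ 0) (h : l.IsHomogeneous 1) : Prime l :=
  (irreducible_lin h0 h).prime

lemma prop_of_dvd {l m : R} (hl0 : l ≠ 0) (hl : l.IsHomogeneous 1) (hm0 : m ≠ 0)
    (hm : m.IsHomogeneous 1) (hd : l ∣ m) : ∃ c : ℂ, m = C c * l := by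
  obtain ⟨q, rfl⟩ := hd
  have hq : q ≠ 0 := right_ne_zero_of_mul hm0
  have := hm.totalDegree hm0
  rw [totalDegree_mul_of_isDomain hl0 hq, hl.totalDegree hl0] at this
  have h2 : q.totalDegree = 0 := by omega
  rw [totalDegree_eq_zero_iff_eq_C] at h2
  exact ⟨_, by rw [mul_comm, ← h2]⟩

/-- Translation to `P` with an order parameter. -/
noncomputable def phi (P : Fin 3 → ℂ) : R →ₐ[ℂ] Polynomial R :=
  aeval (fun i => Polynomial.C (X i) * Polynomial.X + Polynomial.C (C (P i)))

lemma phi_inj (P : Fin 3 → ℂ) : Function.Injective (phi P) := by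
  have key : ∀ p : R, aeval (fun i => (X i - C (P i) : R)) (Polynomial.eval 1 (phi P p)) = p := by
    intro p
    induction p using MvPolynomial.induction_on with
    | C a => 
      have : phi P (C a) = Polynomial.C (C a) := by
        rw [← algebraMap_eq, AlgHom.commutes]; rfl
      simp [this]
    | add p q hp hq => rw [map_add, Polynomial.eval_add, map_add, hp, hq]
    | mul_X p i hp =>
      rw [map_mul, Polynomial.eval_mul, map_mul, hp]
      simp [phi]
  intro a b h
  rw [← key a, h, key]

lemma phi_C (P : Fin 3 → ℂ) (a : ℂ) : phi P (C a) = Polynomial.C (C a) := by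
  rw [← algebraMap_eq, AlgHom.commutes]; rfl

lemma phi_lin (P : Fin 3 → ℂ) {l : R} (h : l.IsHomogeneous 1) :
    phi P l = Polynomial.C l * Polynomial.X + Polynomial.C (C (eval P l)) := by
  obtain ⟨v, rfl⟩ := exists_coeffs h
  rw [eval_lin]
  simp only [map_sum, map_mul, phi_C, Finset.sum_mul, ← Finset.sum_add_distrib]
  refine Finset.sum_congr rfl fun k _ => ?_
  simp [phi]
  ring

/-- leading part at `P` of a linear form -/
noncomputable def wt (P : Fin 3 → ℂ) (l : R) : R := if eval P l = 0 then l else C (eval P l)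

lemma phi_lin_deg (P : Fin 3 → ℂ) {l : R} (h0 : l ≠ 0) (h : l.IsHomogeneous 1) :
    (phi P l).natTrailingDegree = (if eval P l = 0 then 1 else 0) ∧
    (phi P l).trailingCoeff = wt P l := by
  unfold wt
  rw [phi_lin P h]
  split_ifs with he
  · rw [he]
    simp only [map_zero, add_zero]
    constructor
    · rw [Polynomial.natTrailingDegree_mul (by simpa using h0) Polynomial.X_ne_zero]; simp
    · rw [Polynomial.trailingCoeff_mul]
      simp [Polynomial.trailingCoeff]
  · have : (Polynomial.C l * Polynomial.X + Polynomial.C (C (eval P l))).natTrailingDegree = 0 := by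
      apply Polynomial.natTrailingDegree_eq_zero_of_constantCoeff_ne_zero
      simpa using he
    refine ⟨this, ?_⟩
    rw [Polynomial.trailingCoeff, this]
    simp

lemma prod_trailing {ι : Type*} (s : Finset ι) (f : ι → Polynomial R) (hf : ∀ i ∈ s, f i ≠ 0) :
    (∏ i ∈ s, f i).natTrailingDegree = ∑ i ∈ s, (f i).natTrailingDegree ∧
    (∏ i ∈ s, f i).trailingCoeff = ∏ i ∈ s, (f i).trailingCoeff := by
  classical
  induction s using Finset.induction_on with
  | empty => simp [Polynomial.trailingCoeff]
  | insert a s ha ih =>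
    obtain ⟨h1, h2⟩ := ih fun i hi => hf i (Finset.mem_insert_of_mem hi)
    rw [Finset.prod_insert ha, Finset.sum_insert ha, Finset.prod_insert ha,
      Polynomial.natTrailingDegree_mul (hf a (Finset.mem_insert_self _ _))
      (Finset.prod_ne_zero_iff.2 fun i hi => hf i (Finset.mem_insert_of_mem hi)),
      Polynomial.trailingCoeff_mul, h1, h2]
    exact ⟨rfl, rfl⟩

lemma trail3 {x y z : Polynomial R} (hx : x ≠ 0) (hy : y ≠ 0) (hz : z ≠ 0) (h : x + y + z = 0)
    (h1 : z.natTrailingDegree ≠ x.natTrailingDegree)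
    (h2 : z.natTrailingDegree ≠ y.natTrailingDegree) :
    x.natTrailingDegree = y.natTrailingDegree ∧ x.trailingCoeff + y.trailingCoeff = 0 := by
  have c : ∀ k, x.coeff k + y.coeff k + z.coeff k = 0 := fun k => by
    rw [← Polynomial.coeff_add, ← Polynomial.coeff_add, h, Polynomial.coeff_zero]
  have nz : ∀ {w : Polynomial R}, w ≠ 0 → w.coeff w.natTrailingDegree ≠ 0 := fun hw =>
    Polynomial.trailingCoeff_nonzero_iff_nonzero.2 hw
  have lt : ∀ {w : Polynomial R} {k}, k < w.natTrailingDegree → w.coeff k = 0 := fun hk =>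
    Polynomial.coeff_eq_zero_of_lt_natTrailingDegree hk
  have hzx : x.natTrailingDegree < z.natTrailingDegree ∨ y.natTrailingDegree < z.natTrailingDegree := by
    by_contra! hcon
    have := c z.natTrailingDegree
    rw [lt (lt_of_le_of_ne hcon.1 h1), lt (lt_of_le_of_ne hcon.2 h2)] at this
    rw [zero_add, zero_add] at this
    exact nz hz this
  have e : x.natTrailingDegree = y.natTrailingDegree := by
    rcases lt_trichotomy x.natTrailingDegree y.natTrailingDegree with hh | hh | hh
    · have := c x.natTrailingDegree
      rw [lt hh, lt (w := z) (by omega), add_zero, add_zero] at this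
      exact absurd this (nz hx)
    · exact hh
    · have := c y.natTrailingDegree
      rw [lt hh, lt (w := z) (by omega), zero_add, add_zero] at this
      exact absurd this (nz hy)
  refine ⟨e, ?_⟩
  have := c x.natTrailingDegree
  rw [lt (w := z) (by omega), add_zero] at this
  rw [Polynomial.trailingCoeff, Polynomial.trailingCoeff, ← e]
  exact this

lemma cube_contra {p a b f g : R} (hp : Prime p) (ha : ¬ p ∣ a) (hb : ¬ p ∣ b) (hf : f ≠ 0)
    (hg : g ≠ 0) (h : p * a * f ^ 3 + b * g ^ 3 = 0) : False := by
  obtain ⟨f', hfe, hf'⟩ :=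
    (FiniteMultiplicity.of_prime_left hp hf).exists_eq_pow_mul_and_not_dvd
  obtain ⟨g', hge, hg'⟩ :=
    (FiniteMultiplicity.of_prime_left hp hg).exists_eq_pow_mul_and_not_dvd
  generalize multiplicity p f = k at hfe
  generalize multiplicity p g = m at hge
  subst hfe hge
  have hp0 := hp.ne_zero
  rcases lt_or_ge k m with hkm | hkm
  · obtain ⟨t, rfl⟩ := Nat.exists_eq_add_of_lt hkm
    have : a * f' ^ 3 + p * (p * (b * (p ^ t * g') ^ 3)) = 0 := by
      have : p ^ (3 * k + 1) * (a * f' ^ 3 + p * (p * (b * (p ^ t * g') ^ 3))) = 0 := by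
        rw [← h]; ring
      exact (mul_eq_zero.1 this).resolve_left (pow_ne_zero _ hp0)
    have hd : p ∣ a * f' ^ 3 := ⟨-(p * (b * (p ^ t * g') ^ 3)), by linear_combination this⟩
    rcases hp.dvd_or_dvd hd with h1 | h1
    · exact ha h1
    · exact hf' (hp.dvd_of_dvd_pow h1)
  · obtain ⟨t, rfl⟩ := Nat.exists_eq_add_of_le hkm
    have : p * (a * (p ^ t * f') ^ 3) + b * g' ^ 3 = 0 := by
      have : p ^ (3 * m) * (p * (a * (p ^ t * f') ^ 3) + b * g' ^ 3) = 0 := by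
        rw [← h]; ring
      exact (mul_eq_zero.1 this).resolve_left (pow_ne_zero _ hp0)
    have hd : p ∣ b * g' ^ 3 := ⟨-((a * (p ^ t * f') ^ 3)), by linear_combination this⟩
    rcases hp.dvd_or_dvd hd with h1 | h1
    · exact hb h1
    · exact hg' (hp.dvd_of_dvd_pow h1)

/-- the product of forms of colour `a` -/
noncomputable def AA {n : ℕ} (L : Fin n → R) (c : Fin n → Fin 3) (a : Fin 3) : R :=
  ∏ j with c j = a, L j

def Sol {n : ℕ} (L : Fin n → R) (c : Fin n → Fin 3) (F : Fin 3 → R) : Prop :=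
  (∀ i, F i ≠ 0) ∧ ∑ i, AA L c i * F i ^ 3 = 0

section
variable {n : ℕ} {L : Fin n → R} (hL0 : ∀ i, L i ≠ 0) (hL1 : ∀ i, (L i).IsHomogeneous 1)
  (hprop : ∀ i j, i ≠ j → ∀ c : ℂ, L i ≠ C c * L j)
  (hmult : ∀ P : Fin 3 → ℂ, P ≠ 0 →
      (Finset.univ.filter fun i => MvPolynomial.eval P (L i) = 0).card ≤ 3)

include hL0 in
lemma AA_ne (c : Fin n → Fin 3) (a : Fin 3) : AA L c a ≠ 0 :=
  Finset.prod_ne_zero_iff.2 fun i _ => hL0 i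

include hL0 hL1 hprop in
lemma not_dvd {i j : Fin n} (hij : i ≠ j) : ¬ L i ∣ L j := fun hd => by
  obtain ⟨c, hc⟩ := prop_of_dvd (hL0 i) (hL1 i) (hL0 j) (hL1 j) hd
  exact hprop j i hij.symm c hc

include hL0 hL1 in
lemma AA_trailing (P : Fin 3 → ℂ) (c : Fin n → Fin 3) (a : Fin 3) :
    (phi P (AA L c a)).natTrailingDegree =
      (Finset.univ.filter fun j => c j = a ∧ eval P (L j) = 0).card ∧
    (phi P (AA L c a)).trailingCoeff = ∏ j with c j = a, wt P (L j) := by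
  unfold AA
  rw [map_prod]
  have := prod_trailing (Finset.univ.filter fun j => c j = a) (fun j => phi P (L j))
    (fun j _ => by rw [Ne, map_eq_zero_iff _ (phi_inj P)]; exact hL0 j)
  rw [this.1, this.2]
  constructor
  · rw [Finset.sum_congr rfl fun j _ => (phi_lin_deg P (hL0 j) (hL1 j)).1, Finset.sum_boole,
      Finset.filter_filter]
    simp
  · exact Finset.prod_congr rfl fun j _ => (phi_lin_deg P (hL0 j) (hL1 j)).2

include hL0 hL1 hprop in
lemma not_dvd_wt (P : Fin 3 → ℂ) {i j : Fin n} (hij : i ≠ j) : ¬ L i ∣ wt P (L j) := by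
  unfold wt
  split_ifs with h
  · exact not_dvd hL0 hL1 hprop hij
  · intro hd
    have hu : IsUnit (C (eval P (L j)) : R) := (isUnit_iff_ne_zero.2 h).map C
    exact (prime_lin (hL0 i) (hL1 i)).not_isUnit (isUnit_of_dvd_unit hd hu)

include hL0 hL1 hprop hmult in
lemma local_net {c : Fin n → Fin 3} {F : Fin 3 → R} (hS : Sol L c F) {i j : Fin n}
    (hij : c i ≠ c j) {P : Fin 3 → ℂ} (hP : P ≠ 0) (hi : eval P (L i) = 0)
    (hj : eval P (L j) = 0) (a : Fin 3) :
    (Finset.univ.filter fun k => c k = a ∧ eval P (L k) = 0).card = 1 := by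
  set K : Fin 3 → ℕ := fun a => (Finset.univ.filter fun k => c k = a ∧ eval P (L k) = 0).card
    with hK
  have hKs : ∑ a, K a ≤ 3 := by
    refine le_trans (le_of_eq ?_) (hmult P hP)
    rw [Finset.card_eq_sum_card_fiberwise (f := c) (t := Finset.univ) (by simp)]
    refine Finset.sum_congr rfl fun a _ => ?_
    rw [hK, Finset.filter_filter]
    simp only [and_comm]
  have hKi : 1 ≤ K (c i) := Finset.card_pos.2 ⟨i, by simp [hi]⟩
  have hKj : 1 ≤ K (c j) := Finset.card_pos.2 ⟨j, by simp [hj]⟩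
  obtain ⟨e, hei, hej, hsum⟩ : ∃ e, e ≠ c i ∧ e ≠ c j ∧
      ∀ (M : Type) [AddCommMonoid M] (f : Fin 3 → M), ∑ a, f a = f (c i) + f (c j) + f e := by
    generalize c i = u at *
    generalize c j = v at *
    have : ∃ e, e ≠ u ∧ e ≠ v := by clear hKi hKj; revert u v; decide
    obtain ⟨e, h1, h2⟩ := this
    refine ⟨e, h1, h2, fun M _ f => ?_⟩
    have : (Finset.univ : Finset (Fin 3)) = {u, v, e} := by
      clear hKi hKj
      revert u v e; decide
    rw [this, Finset.sum_insert (by simp [hij, h1.symm]), Finset.sum_insert (by simp [h2.symm]),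
      Finset.sum_singleton, add_assoc]
  have hKs' := hsum ℕ K
  by_cases hKe : 1 ≤ K e
  · have : K (c i) = 1 ∧ K (c j) = 1 ∧ K e = 1 := by omega
    show K a = 1
    have : ∀ a : Fin 3, a = c i ∨ a = c j ∨ a = e := by
      clear_value K
      clear hKs hKi hKj hKs' hsum this hKe
      generalize c i = u at *
      generalize c j = v at *
      revert u v e; decide
    rcases this a with rfl | rfl | rfl <;> omega
  exfalso
  have hinj := phi_inj P
  have hA0 : ∀ a, phi P (AA L c a) ≠ 0 := fun a => by
    rw [Ne, map_eq_zero_iff _ hinj]; exact AA_ne hL0 c a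
  have hF0 : ∀ a, phi P (F a) ≠ 0 := fun a => by
    rw [Ne, map_eq_zero_iff _ hinj]; exact hS.1 a
  set G : Fin 3 → Polynomial R := fun a => phi P (AA L c a) * phi P (F a) ^ 3 with hG
  have hG0 : ∀ a, G a ≠ 0 := fun a => mul_ne_zero (hA0 a) (pow_ne_zero _ (hF0 a))
  have hGs : G (c i) + G (c j) + G e = 0 := by
    rw [← hsum]
    have := congrArg (phi P) hS.2
    simpa [map_sum] using this
  have hGd : ∀ a, (G a).natTrailingDegree = K a + 3 * (phi P (F a)).natTrailingDegree := by
    intro a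
    simp only [hG]
    rw [Polynomial.natTrailingDegree_mul (hA0 a) (pow_ne_zero _ (hF0 a)),
      (AA_trailing hL0 hL1 P c a).1]
    congr 1
    rw [pow_succ, pow_two, Polynomial.natTrailingDegree_mul (mul_ne_zero (hF0 a) (hF0 a)) (hF0 a),
      Polynomial.natTrailingDegree_mul (hF0 a) (hF0 a)]
    ring
  have hGt : ∀ a, (G a).trailingCoeff =
      (∏ j with c j = a, wt P (L j)) * (phi P (F a)).trailingCoeff ^ 3 := by
    intro a
    simp only [hG]
    rw [Polynomial.trailingCoeff_mul, (AA_trailing hL0 hL1 P c a).2, pow_succ, pow_two,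
      Polynomial.trailingCoeff_mul, Polynomial.trailingCoeff_mul]
    ring
  have hi' := hGd (c i)
  have hj' := hGd (c j)
  have he' := hGd e
  obtain ⟨h1, h2⟩ := trail3 (hG0 _) (hG0 _) (hG0 _) hGs (by omega) (by omega)
  rw [hGt, hGt, ← Finset.mul_prod_erase (Finset.univ.filter fun k => c k = c i) _ (a := i)
    (by simp)] at h2
  have hw : wt P (L i) = L i := by simp [wt, hi]
  rw [hw] at h2
  have hp := prime_lin (hL0 i) (hL1 i)
  refine cube_contra hp ?_ ?_ ?_ ?_ h2
  · intro hd
    obtain ⟨k, hk, hkd⟩ := (Prime.dvd_finsetProd_iff hp _).1 hd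
    exact not_dvd_wt hL0 hL1 hprop P (Finset.ne_of_mem_erase hk).symm hkd
  · intro hd
    obtain ⟨k, hk, hkd⟩ := (Prime.dvd_finsetProd_iff hp _).1 hd
    refine not_dvd_wt hL0 hL1 hprop P ?_ hkd
    rintro rfl
    exact hij (by simpa using hk)
  · exact Polynomial.trailingCoeff_nonzero_iff_nonzero.2 (hF0 _)
  · exact Polynomial.trailingCoeff_nonzero_iff_nonzero.2 (hF0 _)

end

lemma common_zero {l m : R} (hl : l.IsHomogeneous 1) (hm : m.IsHomogeneous 1) :
    ∃ P : Fin 3 → ℂ, P ≠ 0 ∧ eval P l = 0 ∧ eval P m = 0 := by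
  obtain ⟨v, rfl⟩ := exists_coeffs hl
  obtain ⟨w, rfl⟩ := exists_coeffs hm
  obtain ⟨P, hP, h⟩ := (Matrix.exists_mulVec_eq_zero_iff (M := (!![v 0, v 1, v 2; w 0, w 1, w 2;
    0, 0, 0] : Matrix (Fin 3) (Fin 3) ℂ))).2 (by simp [Matrix.det_fin_three])
  refine ⟨P, hP, ?_, ?_⟩
  · have := congrFun h 0
    rw [eval_lin]
    simpa [Matrix.mulVec, dotProduct, Fin.sum_univ_three] using this
  · have := congrFun h 1
    rw [eval_lin]
    simpa [Matrix.mulVec, dotProduct, Fin.sum_univ_three] using this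

lemma span3 {l m q : R} (hl : l.IsHomogeneous 1) (hm : m.IsHomogeneous 1) (hq : q.IsHomogeneous 1)
    {P : Fin 3 → ℂ} (hP : P ≠ 0) (h1 : eval P l = 0) (h2 : eval P m = 0) (h3 : eval P q = 0) :
    ∃ w : Fin 3 → ℂ, w ≠ 0 ∧ C (w 0) * l + C (w 1) * m + C (w 2) * q = 0 := by
  obtain ⟨a, rfl⟩ := exists_coeffs hl
  obtain ⟨b, rfl⟩ := exists_coeffs hm
  obtain ⟨d, rfl⟩ := exists_coeffs hq
  rw [eval_lin] at h1 h2 h3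
  have hdet : Matrix.det (Matrix.of ![a, b, d] : Matrix (Fin 3) (Fin 3) ℂ) = 0 := by
    rw [← Matrix.exists_mulVec_eq_zero_iff]
    refine ⟨P, hP, ?_⟩
    funext k
    fin_cases k
    · simpa [Matrix.mulVec, dotProduct] using h1
    · simpa [Matrix.mulVec, dotProduct] using h2
    · simpa [Matrix.mulVec, dotProduct] using h3
  obtain ⟨w, hw, h⟩ := Matrix.exists_vecMul_eq_zero_iff.2 hdet
  refine ⟨w, hw, ?_⟩
  have hk : ∀ k, w 0 * a k + w 1 * b k + w 2 * d k = 0 := fun k => by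
    have := congrFun h k
    simpa [Matrix.vecMul, dotProduct, Fin.sum_univ_three] using this
  rw [Finset.mul_sum, Finset.mul_sum, Finset.mul_sum, ← Finset.sum_add_distrib,
    ← Finset.sum_add_distrib]
  refine Finset.sum_eq_zero fun k _ => ?_
  have := congrArg (C : ℂ → R) (hk k)
  simp only [map_add, map_mul, map_zero] at this
  linear_combination (X k : R) * this

section
variable {n : ℕ} {L : Fin n → R} (hL0 : ∀ i, L i ≠ 0) (hL1 : ∀ i, (L i).IsHomogeneous 1)
  (hprop : ∀ i j, i ≠ j → ∀ c : ℂ, L i ≠ C c * L j)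
  (hmult : ∀ P : Fin 3 → ℂ, P ≠ 0 →
      (Finset.univ.filter fun i => MvPolynomial.eval P (L i) = 0).card ≤ 3)

include hL0 hL1 hprop in
lemma relprime {i j : Fin n} (hij : i ≠ j) : IsRelPrime (L i) (L j) :=
  (irreducible_lin (hL0 i) (hL1 i)).isRelPrime_iff_not_dvd.2 (not_dvd hL0 hL1 hprop hij)

include hL0 hL1 hprop hmult in
lemma tau {c : Fin n → Fin 3} {F : Fin 3 → R} (hS : Sol L c F) {i j : Fin n}
    (hij : c i ≠ c j) {e : Fin 3} (hi : e ≠ c i) (hj : e ≠ c j) :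
    ∃ k, c k = e ∧ ∃ b : ℂ, b ≠ 0 ∧ L i ∣ L k - C b * L j := by
  obtain ⟨P, hP, h1, h2⟩ := common_zero (hL1 i) (hL1 j)
  have hc := local_net hL0 hL1 hprop hmult hS hij hP h1 h2 e
  obtain ⟨k, hk⟩ := Finset.card_pos.1 (by rw [hc]; exact one_pos)
  simp only [Finset.mem_filter, Finset.mem_univ, true_and] at hk
  obtain ⟨hke, h3⟩ := hk
  obtain ⟨w, hw, h⟩ := span3 (hL1 i) (hL1 j) (hL1 k) hP h1 h2 h3
  have hij' : i ≠ j := fun h => hij (by rw [h])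
  have hik : i ≠ k := fun h => hi (by rw [h, hke])
  have hjk : j ≠ k := fun h => hj (by rw [h, hke])
  have unitC : ∀ {a : ℂ}, a ≠ 0 → IsUnit (C a : R) := fun ha => (isUnit_iff_ne_zero.2 ha).map C
  have hp := prime_lin (hL0 i) (hL1 i)
  have nd : ∀ {a : ℂ} {m : Fin n}, a ≠ 0 → i ≠ m → ¬ L i ∣ C a * L m := by
    intro a m ha hm hd
    rcases hp.dvd_or_dvd hd with hd | hd
    · exact hp.not_isUnit (isUnit_of_dvd_unit hd (unitC ha))
    · exact not_dvd hL0 hL1 hprop hm hd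
  have hw2 : w 2 ≠ 0 := by
    intro h0
    rw [h0] at h
    by_cases hw1 : w 1 = 0
    · have hw0 : w 0 ≠ 0 := by
        intro h00
        apply hw
        funext t
        fin_cases t <;> simp [h0, hw1, h00]
      rw [hw1] at h
      simp [hw0, hL0] at h
    · refine nd hw1 hij' ⟨-C (w 0), ?_⟩
      simp only [map_zero] at h
      linear_combination h
  have hw1 : w 1 ≠ 0 := by
    intro h0
    rw [h0] at h
    refine nd hw2 hik ⟨-C (w 0), ?_⟩
    simp only [map_zero] at h
    linear_combination h
  refine ⟨k, hke, -(w 1 / w 2), by simp [hw1, hw2], ⟨-C (w 0 / w 2), ?_⟩⟩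
  have e1 : (C (w 2) : R) * C (w 0 / w 2) = C (w 0) := by rw [← C_mul]; congr 1; field_simp
  have e2 : (C (w 2) : R) * C (w 1 / w 2) = C (w 1) := by rw [← C_mul]; congr 1; field_simp
  have hC : (C (w 2) : R) ≠ 0 := by simpa using hw2
  apply mul_left_cancel₀ hC
  rw [map_neg]
  linear_combination h + L i * e1 + L j * e2

include hL0 hL1 hprop hmult in
lemma tau_map {c : Fin n → Fin 3} {F : Fin 3 → R} (hS : Sol L c F) (i : Fin n)
    {u e : Fin 3} (hu : u ≠ c i) (he : e ≠ c i) (hue : u ≠ e) :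
    ∃ t : Fin n → Fin n, ∃ b : Fin n → ℂ, (∀ j, c j = u → c (t j) = e ∧ b j ≠ 0 ∧
      L i ∣ L (t j) - C (b j) * L j) ∧ ∀ j j', c j = u → c j' = u → t j = t j' → j = j' := by
  have : ∀ j, ∃ k, ∃ b : ℂ, c j = u → c k = e ∧ b ≠ 0 ∧ L i ∣ L k - C b * L j := by
    intro j
    by_cases hj : c j = u
    · obtain ⟨k, h1, b, h2, h3⟩ := tau hL0 hL1 hprop hmult hS (i := i) (j := j) (e := e)
        (by rw [hj]; exact hu.symm) he (by rw [hj]; exact hue.symm)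
      exact ⟨k, b, fun _ => ⟨h1, h2, h3⟩⟩
    · exact ⟨j, 0, fun h => absurd h hj⟩
  choose t b h using this
  refine ⟨t, b, h, ?_⟩
  intro j j' hj hj' hjj
  obtain ⟨P, hP, h1, h2⟩ := common_zero (hL1 i) (hL1 (t j))
  have van : ∀ m, c m = u → t m = t j → eval P (L m) = 0 := by
    intro m hm hmt
    obtain ⟨-, hb, q, hq⟩ := h m hm
    have := congrArg (eval P) hq
    rw [hmt] at this
    simpa [h1, h2, hb] using this
  have hc := local_net hL0 hL1 hprop hmult hS (i := i) (j := j) (by rw [hj]; exact hu.symm) hP h1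
    (van j hj rfl) u
  obtain ⟨x, hx⟩ := Finset.card_eq_one.1 hc
  have a1 : j ∈ ({x} : Finset (Fin n)) := by rw [← hx]; simp [hj, van j hj rfl]
  have a2 : j' ∈ ({x} : Finset (Fin n)) := by rw [← hx]; simp [hj', van j' hj' hjj.symm]
  rw [Finset.mem_singleton] at a1 a2
  rw [a1, a2]

include hL0 hL1 hprop hmult in
lemma card_le {c : Fin n → Fin 3} {F : Fin 3 → R} (hS : Sol L c F) (i : Fin n)
    {u e : Fin 3} (hu : u ≠ c i) (he : e ≠ c i) (hue : u ≠ e) :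
    (Finset.univ.filter fun j => c j = u).card ≤ (Finset.univ.filter fun j => c j = e).card := by
  obtain ⟨t, b, h1, h2⟩ := tau_map hL0 hL1 hprop hmult hS i hu he hue
  refine Finset.card_le_card_of_injOn t ?_ ?_
  · intro j hj
    simp only [Finset.coe_filter, Finset.mem_univ, true_and, Set.mem_ofPred_eq] at hj ⊢
    exact (h1 j hj).1
  · intro j hj j' hj'
    simp only [Finset.coe_filter, Finset.mem_univ, true_and, Set.mem_ofPred_eq] at hj hj'
    exact h2 j j' hj hj'

include hL0 hL1 hprop hmult in
lemma mod_eq {c : Fin n → Fin 3} {F : Fin 3 → R} (hS : Sol L c F) (i : Fin n)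
    {u e : Fin 3} (hu : u ≠ c i) (he : e ≠ c i) (hue : u ≠ e) :
    ∃ lam : ℂ, lam ≠ 0 ∧ L i ∣ AA L c e - C lam * AA L c u := by
  obtain ⟨t, b, h1, h2⟩ := tau_map hL0 hL1 hprop hmult hS i hu he hue
  have inj : Set.InjOn t (Finset.univ.filter fun j => c j = u : Finset (Fin n)) := by
    intro j hj j' hj'
    simp only [Finset.coe_filter, Finset.mem_univ, true_and, Set.mem_ofPred_eq] at hj hj'
    exact h2 j j' hj hj'
  have himg : (Finset.univ.filter fun j => c j = u).image t =
      Finset.univ.filter fun j => c j = e := by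
    apply Finset.eq_of_subset_of_card_le
    · intro k hk
      simp only [Finset.mem_image, Finset.mem_filter, Finset.mem_univ, true_and] at hk ⊢
      obtain ⟨j, hj, rfl⟩ := hk
      exact (h1 j hj).1
    · rw [Finset.card_image_of_injOn inj]
      exact card_le hL0 hL1 hprop hmult hS i he hu hue.symm
  refine ⟨∏ j with c j = u, b j, Finset.prod_ne_zero_iff.2 fun j hj => (h1 j (by simpa using hj)).2.1, ?_⟩
  unfold AA
  rw [← himg, Finset.prod_image inj, ← Ideal.mem_span_singleton, ← Ideal.Quotient.eq, map_prod,
    map_prod, ← Finset.prod_mul_distrib, map_prod]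
  refine Finset.prod_congr rfl fun j hj => ?_
  rw [Ideal.Quotient.eq, Ideal.mem_span_singleton]
  exact (h1 j (by simpa using hj)).2.2

lemma AA_hom (hL1 : ∀ i, (L i).IsHomogeneous 1) (c : Fin n → Fin 3) (a : Fin 3) :
    (AA L c a).IsHomogeneous (Finset.univ.filter fun j => c j = a).card := by
  have := IsHomogeneous.prod (Finset.univ.filter fun j => c j = a) L (fun _ => 1) fun i _ => hL1 i
  simpa [AA] using this

include hL0 hL1 hprop hmult in
lemma net_concl {c : Fin n → Fin 3} {F : Fin 3 → R} (hS : Sol L c F) {i j : Fin n}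
    (hij : c i ≠ c j) : ∃ lam mu : ℂ, lam ≠ 0 ∧ mu ≠ 0 ∧
      AA L c 2 = C lam * AA L c 1 + C mu * AA L c 0 := by
  have ex : ∀ a, ∃ k, c k = a := by
    intro a
    by_cases h1 : a = c i
    · exact ⟨i, h1.symm⟩
    by_cases h2 : a = c j
    · exact ⟨j, h2.symm⟩
    obtain ⟨k, hk, -⟩ := tau hL0 hL1 hprop hmult hS hij h1 h2
    exact ⟨k, hk⟩
  have cards : ∀ u e : Fin 3, (Finset.univ.filter fun j => c j = u).card ≤
      (Finset.univ.filter fun j => c j = e).card := by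
    intro u e
    by_cases hue : u = e
    · rw [hue]
    obtain ⟨a, ha1, ha2⟩ : ∃ a, u ≠ a ∧ e ≠ a := by
      clear * - hue
      revert u e; decide
    obtain ⟨k, rfl⟩ := ex a
    exact card_le hL0 hL1 hprop hmult hS k ha1 ha2 hue
  obtain ⟨i0, hi0⟩ := ex 0
  obtain ⟨lam, hlam, hd0⟩ := mod_eq hL0 hL1 hprop hmult hS i0 (u := 1) (e := 2)
    (by rw [hi0]; decide) (by rw [hi0]; decide) (by decide)
  have hall : ∀ k, c k = 0 → L k ∣ AA L c 2 - C lam * AA L c 1 := by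
    intro k hk
    by_cases hki : k = i0
    · rw [hki]; exact hd0
    obtain ⟨lam', -, hd⟩ := mod_eq hL0 hL1 hprop hmult hS k (u := 1) (e := 2)
      (by rw [hk]; decide) (by rw [hk]; decide) (by decide)
    obtain ⟨P, hP, h1, h2⟩ := common_zero (hL1 i0) (hL1 k)
    have hne : eval P (AA L c 1) ≠ 0 := by
      unfold AA
      rw [map_prod, Finset.prod_ne_zero_iff]
      intro m hm hv
      have hm : c m = 1 := by simpa using hm
      have hc := local_net hL0 hL1 hprop hmult hS (i := k) (j := m) (by rw [hk, hm]; decide) hP h2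
        hv 0
      obtain ⟨x, hx⟩ := Finset.card_eq_one.1 hc
      have a1 : k ∈ ({x} : Finset (Fin n)) := by rw [← hx]; simp [hk, h2]
      have a2 : i0 ∈ ({x} : Finset (Fin n)) := by rw [← hx]; simp [hi0, h1]
      rw [Finset.mem_singleton] at a1 a2
      exact hki (by rw [a1, a2])
    obtain ⟨q, hq⟩ := hd
    obtain ⟨q0, hq0⟩ := hd0
    have e1 := congrArg (eval P) hq
    have e2 := congrArg (eval P) hq0
    simp only [map_sub, map_mul, eval_C, h1, h2, zero_mul] at e1 e2
    have : (lam - lam') * eval P (AA L c 1) = 0 := by linear_combination e1 - e2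
    have hll : lam = lam' := sub_eq_zero.1 ((mul_eq_zero.1 this).resolve_right hne)
    rw [hll]
    exact ⟨q, hq⟩
  have hdiv : AA L c 0 ∣ AA L c 2 - C lam * AA L c 1 := by
    apply Finset.prod_dvd_of_isRelPrime
    · intro a _ b _ hab
      exact relprime hL0 hL1 hprop hab
    · intro k hk
      exact hall k (by simpa using hk)
  obtain ⟨q, hq⟩ := hdiv
  have hq0 : q ≠ 0 := by
    rintro rfl
    obtain ⟨k, hk⟩ := ex 2
    have hp := prime_lin (hL0 k) (hL1 k)
    have hd : L k ∣ C lam * AA L c 1 := by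
      have : C lam * AA L c 1 = AA L c 2 := by linear_combination -hq
      rw [this]
      exact Finset.dvd_prod_of_mem _ (by simp [hk])
    rcases hp.dvd_or_dvd hd with hd | hd
    · exact hp.not_isUnit (isUnit_of_dvd_unit hd ((isUnit_iff_ne_zero.2 hlam).map C))
    · obtain ⟨m, hm, hmd⟩ := (Prime.dvd_finsetProd_iff hp _).1 hd
      have hm : c m = 1 := by simpa using hm
      refine not_dvd hL0 hL1 hprop ?_ hmd
      rintro rfl
      rw [hk] at hm
      exact absurd hm (by decide)
  have hdeg : q.totalDegree = 0 := by
    have h1 := totalDegree_mul_of_isDomain (AA_ne hL0 c 0) hq0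
    rw [← hq, (AA_hom hL1 c 0).totalDegree (AA_ne hL0 c 0)] at h1
    have h2 := totalDegree_sub (AA L c 2) (C lam * AA L c 1)
    have h3 := ((AA_hom hL1 c 1).C_mul lam).totalDegree_le
    have h4 := (AA_hom hL1 c 2).totalDegree_le
    have h5 := cards 1 0
    have h6 := cards 2 0
    have h7 := h2.trans (max_le (h4.trans h6) (h3.trans h5))
    omega
  rw [totalDegree_eq_zero_iff_eq_C] at hdeg
  refine ⟨lam, coeff 0 q, hlam, ?_, ?_⟩
  · intro h0
    rw [h0] at hdeg
    simp at hdeg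
    exact hq0 hdeg
  · rw [← hdeg]
    linear_combination hq

lemma prime_deg {p : R} (hp : Prime p) : 0 < p.totalDegree := by
  by_contra! h
  have h : p.totalDegree = 0 := by omega
  apply hp.not_isUnit
  rw [totalDegree_eq_zero_iff_eq_C] at h
  rw [h]
  refine (isUnit_iff_ne_zero.2 ?_).map C
  intro h0
  rw [h0] at h
  exact hp.ne_zero (by simpa using h)

include hL0 hL1 hprop in
lemma squarefree_all : Squarefree (∏ j, L j) := by
  apply Finset.squarefree_prod_of_pairwise_isCoprime
  · intro a _ b _ hab
    exact relprime hL0 hL1 hprop hab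
  · intro i _
    exact (irreducible_lin (hL0 i) (hL1 i)).squarefree

lemma cube_of_relprime {a b d : R} (hab : IsRelPrime a b) (h : a * b = d ^ 3) (w : ℂ) :
    ∃ q : R, C w * a = q ^ 3 := by
  classical
  let _ : GCDMonoid R := UniqueFactorizationMonoid.toGCDMonoid R
  obtain ⟨q, u, hu⟩ := exists_associated_pow_of_mul_eq_pow (gcd_isUnit_iff_isRelPrime.2 hab) h
  obtain ⟨r, -, hr⟩ := isUnit_iff_eq_C_of_isReduced.1 u.isUnit
  obtain ⟨s, hs⟩ := IsAlgClosed.exists_pow_nat_eq (w * r) (n := 3) (by norm_num)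
  refine ⟨C s * q, ?_⟩
  rw [mul_pow, ← C_pow, hs, ← hu, hr, C_mul]
  ring

include hL0 hL1 hprop in
lemma descent (hn : 0 < n) {f g h : R} (hf : f ≠ 0) (hg : g ≠ 0) (hh : h ≠ 0)
    (heq : f ^ 3 + g ^ 3 + (∏ j, L j) * h ^ 3 = 0) :
    ∃ c F, Sol L c F ∧ ∀ i, (F i).totalDegree <
      max f.totalDegree (max g.totalDegree h.totalDegree) := by
  set D : R := ∏ j, L j with hD
  by_cases hcop : ∃ p, Prime p ∧ p ∣ f ∧ p ∣ g
  · obtain ⟨p, hp, ⟨f', rfl⟩, ⟨g', rfl⟩⟩ := hcop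
    have hph : p ∣ h := by
      by_contra hph
      have h3 : p ^ 3 ∣ D * h ^ 3 := ⟨-(f' ^ 3 + g' ^ 3), by linear_combination heq⟩
      have h4 : p ^ 3 ∣ D := hp.pow_dvd_of_dvd_mul_right 3 (fun h => hph (hp.dvd_of_dvd_pow h)) h3
      have h5 : p * p ∣ D := (Dvd.intro p (by ring)).trans h4
      exact hp.not_isUnit (squarefree_all hL0 hL1 hprop p h5)
    obtain ⟨h', rfl⟩ := hph
    have hp0 := hp.ne_zero
    have hf' : f' ≠ 0 := right_ne_zero_of_mul hf
    have hg' : g' ≠ 0 := right_ne_zero_of_mul hg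
    have hh' : h' ≠ 0 := right_ne_zero_of_mul hh
    have hpd := prime_deg hp
    rw [totalDegree_mul_of_isDomain hp0 hf', totalDegree_mul_of_isDomain hp0 hg',
      totalDegree_mul_of_isDomain hp0 hh']
    refine ⟨fun _ => 2, ![f', g', h'], ⟨?_, ?_⟩, ?_⟩
    · intro i; fin_cases i <;> simpa
    · have : p ^ 3 * (f' ^ 3 + g' ^ 3 + D * h' ^ 3) = 0 := by rw [← heq]; ring
      have := (mul_eq_zero.1 this).resolve_left (pow_ne_zero _ hp0)
      simp [Fin.sum_univ_three, AA, ← hD, this]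
    · intro i; fin_cases i <;> simp <;> omega
  push Not at hcop
  obtain ⟨ω, hω⟩ : ∃ ω : ℂ, IsPrimitiveRoot ω 3 := ⟨_, Complex.isPrimitiveRoot_exp 3 (by norm_num)⟩
  have hsum : 1 + ω + ω ^ 2 = 0 := by
    have := hω.geom_sum_eq_zero (by norm_num)
    simpa [Finset.sum_range_succ] using this
  have hω3 : ω ^ 3 = 1 := hω.pow_eq_one
  have hs' : (1 + C ω + C ω ^ 2 : R) = 0 := by
    have := congrArg (C : ℂ → R) hsum
    simpa using this
  have hω3' : (C ω ^ 3 : R) = 1 := by rw [← C_pow, hω3, C_1]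
  set p : Fin 3 → R := fun i => f + C (ω ^ (i : ℕ)) * g with hp
  have hprod : ∏ i, p i = -(D * h ^ 3) := by
    simp only [hp, Fin.prod_univ_three]
    simp
    linear_combination heq + (f ^ 2 * g + f * g ^ 2 * C ω) * hs' + g ^ 3 * hω3'
  have hD0 : D ≠ 0 := Finset.prod_ne_zero_iff.2 fun i _ => hL0 i
  have hp0 : ∀ i, p i ≠ 0 := by
    have : ∏ i, p i ≠ 0 := by
      rw [hprod]; exact neg_ne_zero.2 (mul_ne_zero hD0 (pow_ne_zero _ hh))
    intro i
    exact Finset.prod_ne_zero_iff.1 this i (Finset.mem_univ _)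
  have hpc : ∀ i j, i ≠ j → ∀ q, Prime q → q ∣ p i → ¬ q ∣ p j := by
    intro i j hij q hq h1 h2
    have h3 : q ∣ C (ω ^ (i : ℕ) - ω ^ (j : ℕ)) * g := by
      have : C (ω ^ (i : ℕ) - ω ^ (j : ℕ)) * g = p i - p j := by
        simp only [hp, C_sub]; ring
      rw [this]; exact dvd_sub h1 h2
    have hne : ω ^ (i : ℕ) - ω ^ (j : ℕ) ≠ 0 := by
      intro h0
      exact hij (Fin.ext (hω.pow_inj i.2 j.2 (sub_eq_zero.1 h0)))
    have hqg : q ∣ g := by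
      rcases hq.dvd_or_dvd h3 with h4 | h4
      · exact absurd (isUnit_of_dvd_unit h4 ((isUnit_iff_ne_zero.2 hne).map C)) hq.not_isUnit
      · exact h4
    refine hcop q hq ?_ hqg
    have : f = p i - C (ω ^ (i : ℕ)) * g := by simp only [hp]; ring
    rw [this]
    exact dvd_sub h1 (hqg.mul_left _)
  have hcol : ∀ j, ∃ i, L j ∣ p i := by
    intro j
    have hq := prime_lin (hL0 j) (hL1 j)
    have : L j ∣ ∏ i, p i := by
      rw [hprod, dvd_neg]
      exact (Finset.dvd_prod_of_mem _ (Finset.mem_univ j)).mul_right _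
    obtain ⟨i, -, hi⟩ := (Prime.dvd_finsetProd_iff hq _).1 this
    exact ⟨i, hi⟩
  choose c hc using hcol
  have hAd : ∀ i, AA L c i ∣ p i := by
    intro i
    apply Finset.prod_dvd_of_isRelPrime
    · intro a _ b _ hab
      exact relprime hL0 hL1 hprop hab
    · intro k hk
      have hk : c k = i := by simpa using hk
      rw [← hk]; exact hc k
  choose r hr using hAd
  have hr0 : ∀ i, r i ≠ 0 := fun i => right_ne_zero_of_mul (hr i ▸ hp0 i)
  have hAprod : ∏ i, AA L c i = D := Finset.prod_fiberwise _ _ _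
  have hrprod : ∏ i, r i = (-h) ^ 3 := by
    have : D * ∏ i, r i = D * (-h) ^ 3 := by
      rw [← hAprod, ← Finset.prod_mul_distrib, hAprod, ← Finset.prod_congr rfl fun i _ => hr i,
        hprod]
      ring
    exact mul_left_cancel₀ hD0 this
  have hrc : ∀ i j, i ≠ j → IsRelPrime (r i) (r j) := by
    intro i j hij
    rw [UniqueFactorizationMonoid.isRelPrime_iff_no_prime_factors (hr0 i)]
    intro q h1 h2 hq
    exact hpc i j hij q hq (by rw [hr i]; exact h1.mul_left _) (by rw [hr j]; exact h2.mul_left _)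
  have hcube : ∀ i : Fin 3, ∃ q : R, C (ω ^ (i : ℕ)) * r i = q ^ 3 := by
    intro i
    refine cube_of_relprime (b := ∏ j ∈ Finset.univ.erase i, r j) (d := -h) ?_ ?_ _
    · exact IsRelPrime.prod_right fun j hj => hrc i j (Finset.ne_of_mem_erase hj).symm
    · rw [Finset.mul_prod_erase _ _ (Finset.mem_univ i), hrprod]
  choose F hF using hcube
  have hCne : ∀ i : Fin 3, (C (ω ^ (i : ℕ)) : R) ≠ 0 := fun i => by
    have := hω.ne_zero (by norm_num)
    simp [this]
  have hF0 : ∀ i, F i ≠ 0 := by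
    intro i h0
    have := hF i
    rw [h0] at this
    exact mul_ne_zero (hCne i) (hr0 i) (by simpa using this)
  have hpF : ∀ i : Fin 3, C (ω ^ (i : ℕ)) * p i = AA L c i * F i ^ 3 := by
    intro i
    rw [← hF, hr i]; ring
  refine ⟨c, F, ⟨hF0, ?_⟩, ?_⟩
  · rw [← Finset.sum_congr rfl fun i _ => hpF i]
    simp only [hp, Fin.sum_univ_three]
    simp
    linear_combination (f + g) * hs' + g * C ω * hω3'
  · intro i
    have h1 : (C (ω ^ (i : ℕ)) * p i).totalDegree ≤ max f.totalDegree g.totalDegree := by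
      have h2 := totalDegree_mul (C (ω ^ (i : ℕ))) (p i)
      have h3 := totalDegree_add f (C (ω ^ (i : ℕ)) * g)
      have h4 := totalDegree_mul (C (ω ^ (i : ℕ))) g
      rw [totalDegree_C] at h2 h4
      have h5 : (p i).totalDegree ≤ max f.totalDegree (C (ω ^ (i : ℕ)) * g).totalDegree := h3
      omega
    have hF3 : (F i ^ 3).totalDegree = 3 * (F i).totalDegree := by
      rw [pow_succ, pow_two, totalDegree_mul_of_isDomain (mul_ne_zero (hF0 i) (hF0 i)) (hF0 i),
        totalDegree_mul_of_isDomain (hF0 i) (hF0 i)]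
      ring
    rw [hpF, totalDegree_mul_of_isDomain (AA_ne hL0 c i) (pow_ne_zero _ (hF0 i)), hF3] at h1
    by_contra! hcon
    have z : f.totalDegree = 0 ∧ g.totalDegree = 0 ∧ h.totalDegree = 0 := by omega
    have hDd : 0 < D.totalDegree := by
      have h6 := totalDegree_mul_of_isDomain (hL0 ⟨0, hn⟩)
        (Finset.prod_ne_zero_iff.2 fun i _ => hL0 i :
          ∏ j ∈ Finset.univ.erase (⟨0, hn⟩ : Fin n), L j ≠ 0)
      rw [Finset.mul_prod_erase _ _ (Finset.mem_univ _), (hL1 _).totalDegree (hL0 _)] at h6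
      rw [hD]; omega
    have h7 := totalDegree_mul_of_isDomain hD0 (pow_ne_zero 3 hh)
    have h8 : D * h ^ 3 = -(f ^ 3 + g ^ 3) := by linear_combination heq
    have h9 := totalDegree_add (f ^ 3) (g ^ 3)
    have h10 := totalDegree_pow f 3
    have h11 := totalDegree_pow g 3
    rw [h8, totalDegree_neg] at h7
    rw [z.1] at h10
    rw [z.2.1] at h11
    omega

include hL0 hL1 hprop in
lemma exists_nonconst (hn : 0 < n) (M : ℕ) : ∀ (c : Fin n → Fin 3) (F : Fin 3 → R), Sol L c F →
    (∀ i, (F i).totalDegree ≤ M) → ∃ c F, Sol L c F ∧ ∃ i j, c i ≠ c j := by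
  induction M using Nat.strong_induction_on with
  | _ M ih =>
  intro c F hS hM
  by_cases hc : ∃ i j, c i ≠ c j
  · exact ⟨c, F, hS, hc⟩
  push Not at hc
  obtain ⟨a, ha⟩ : ∃ a, ∀ i, c i = a := ⟨c ⟨0, hn⟩, fun i => hc i _⟩
  obtain ⟨u, v, hua, hva, huv, huniv⟩ : ∃ u v : Fin 3, a ≠ u ∧ a ≠ v ∧ u ≠ v ∧
      Finset.univ = {u, v, a} := by
    clear * -
    revert a; decide
  have hAu : ∀ u, a ≠ u → AA L c u = 1 := by
    intro u hu
    unfold AA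
    rw [Finset.filter_false_of_mem, Finset.prod_empty]
    intro j _
    rw [ha]; exact hu
  have hAa : AA L c a = ∏ j, L j := by
    unfold AA
    rw [Finset.filter_true_of_mem]
    intro j _
    exact ha j
  have heq := hS.2
  rw [huniv, Finset.sum_insert (by simp [huv, hua.symm]), Finset.sum_insert (by simp [hva.symm]),
    Finset.sum_singleton, hAu u hua, hAu v hva, hAa, one_mul, one_mul, ← add_assoc] at heq
  obtain ⟨c', F', hS', hd⟩ := descent hL0 hL1 hprop hn (hS.1 u) (hS.1 v) (hS.1 a) heq
  have hlt : ∀ i, (F' i).totalDegree < M := fun i =>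
    lt_of_lt_of_le (hd i) (max_le (hM u) (max_le (hM v) (hM a)))
  have : 0 < M := lt_of_le_of_lt (Nat.zero_le _) (hlt 0)
  exact ih (M - 1) (by omega) c' F' hS' fun i => by have := hlt i; omega

end

end Catalan

/-- If the Catalan equation `A₁f³ + A₂g³ + A₃h³ = 0`, whose coefficients are
products of pairwise non-proportional linear forms defining a line arrangement with points of
multiplicity at most 3, has a solution in nonzero homogeneous polynomials, then
`A₁A₂A₃ = B₁B₂B₃` (up to a nonzero constant) where `B₁, B₂, B₃` are products of linear forms
which are linearly dependent over `ℂ` with all coefficients nonzero. -/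
theorem stmt0
    (n : ℕ) (L : Fin n → MvPolynomial (Fin 3) ℂ)
    (hL0 : ∀ i, L i ≠ 0)
    (hL1 : ∀ i, (L i).IsHomogeneous 1)
    (hprop : ∀ i j, i ≠ j → ∀ c : ℂ, L i ≠ C c * L j)
    (hmult : ∀ P : Fin 3 → ℂ, P ≠ 0 →
      (Finset.univ.filter fun i => MvPolynomial.eval P (L i) = 0).card ≤ 3)
    (S : Fin 3 → Finset (Fin n))
    (hdisj : ∀ i j, i ≠ j → Disjoint (S i) (S j))
    (hcover : S 0 ∪ S 1 ∪ S 2 = Finset.univ)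
    (A : Fin 3 → MvPolynomial (Fin 3) ℂ)
    (hA : ∀ i, A i = ∏ j ∈ S i, L j)
    (f g h : MvPolynomial (Fin 3) ℂ)
    (hf : f ≠ 0) (hg : g ≠ 0) (hh : h ≠ 0)
    (hfhom : ∃ d, f.IsHomogeneous d)
    (hghom : ∃ d, g.IsHomogeneous d)
    (hhhom : ∃ d, h.IsHomogeneous d)
    (heq : A 0 * f ^ 3 + A 1 * g ^ 3 + A 2 * h ^ 3 = 0) :
    ∃ B : Fin 3 → MvPolynomial (Fin 3) ℂ,
      (∀ i, ∃ m : Multiset (MvPolynomial (Fin 3) ℂ),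
        (∀ l ∈ m, l ≠ 0 ∧ l.IsHomogeneous 1) ∧ B i = m.prod) ∧
      (∃ c : ℂ, c ≠ 0 ∧ B 0 * B 1 * B 2 = C c * (A 0 * A 1 * A 2)) ∧
      (∃ lam : Fin 3 → ℂ, (∀ i, lam i ≠ 0) ∧
        C (lam 0) * B 0 + C (lam 1) * B 1 + C (lam 2) * B 2 = 0) := by
  classical
  rcases Nat.eq_zero_or_pos n with hn | hn
  · subst hn
    have hA1 : ∀ i, A i = 1 := fun i => by
      rw [hA, Finset.prod_eq_one]; intro j; exact j.elim0
    refine ⟨fun _ => 1, fun i => ⟨0, by simp, by simp⟩, ⟨1, one_ne_zero, by simp [hA1]⟩,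
      ![1, 1, -2], ?_, ?_⟩
    · intro i; fin_cases i <;> simp
    · have : (C (2 : ℂ) : MvPolynomial (Fin 3) ℂ) = 2 := map_ofNat C 2
      simp [this]; norm_num
  have hdis : ∀ a b, a ≠ b → ∀ j, j ∈ S a → j ∉ S b := fun a b hab j h1 h2 =>
    Finset.disjoint_left.1 (hdisj a b hab) h1 h2
  have hcov : ∀ j, ∃ a, j ∈ S a := fun j => by
    have : j ∈ S 0 ∪ S 1 ∪ S 2 := by rw [hcover]; simp
    simp only [Finset.mem_union] at this
    rcases this with (h | h) | h
    exacts [⟨0, h⟩, ⟨1, h⟩, ⟨2, h⟩]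
  choose c hc using hcov
  have hSc : ∀ a, S a = Finset.univ.filter fun j => c j = a := by
    intro a
    ext j
    simp only [Finset.mem_filter, Finset.mem_univ, true_and]
    constructor
    · intro h
      by_contra hne
      exact hdis _ _ hne j (hc j) h
    · rintro rfl; exact hc j
  have hAA : ∀ a, A a = Catalan.AA L c a := fun a => by rw [hA, hSc]; rfl
  have hS0 : Catalan.Sol L c ![f, g, h] := by
    refine ⟨?_, ?_⟩
    · intro i; fin_cases i <;> simpa
    · simp only [← hAA, Fin.sum_univ_three]
      simpa using heq
  obtain ⟨M, hM⟩ : ∃ M, ∀ i : Fin 3, ((![f, g, h] : Fin 3 → _) i).totalDegree ≤ M :=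
    ⟨_, fun i => Finset.le_sup (f := fun i : Fin 3 => ((![f, g, h] : Fin 3 → _) i).totalDegree)
      (Finset.mem_univ i)⟩
  obtain ⟨c', F, hS, i, j, hij⟩ := Catalan.exists_nonconst hL0 hL1 hprop hn M c _ hS0 hM
  obtain ⟨lam, mu, hlam, hmu, hrel⟩ := Catalan.net_concl hL0 hL1 hprop hmult hS hij
  refine ⟨Catalan.AA L c', ?_, ⟨1, one_ne_zero, ?_⟩, ![mu, lam, -1], ?_, ?_⟩
  · intro a
    refine ⟨(Finset.univ.filter fun j => c' j = a).val.map L, ?_, rfl⟩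
    intro l hl
    obtain ⟨k, -, rfl⟩ := Multiset.mem_map.1 hl
    exact ⟨hL0 k, hL1 k⟩
  · have e : ∀ c : Fin n → Fin 3, Catalan.AA L c 0 * Catalan.AA L c 1 * Catalan.AA L c 2 =
        ∏ j, L j := fun c => by
      rw [← Fin.prod_univ_three]; exact Finset.prod_fiberwise _ _ _
    rw [e, hAA, hAA, hAA, e]; simp
  · intro a; fin_cases a <;> simp [hlam, hmu]
  · simp [hrel]
    ring
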